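/- arXiv:1706.01968 — 3 statements merged into one kernel-verified Lean document; each statement's English description precedes it below -/
import Mathlib

section
/- Let (S, T) have a min-stable distribution with unit exponential margins and Pickands dependence function A. Then for all a, b > 0, E[S^a T^b] = a·b·Γ(a+b)·∫₀¹ w^{a−1}(1−w)^{b−1}/(A(w))^{a+b} dw, and consequently H_{0,0}(a,b) = Cov(S^a, T^b) = a·b·Γ(a+b)·∫₀¹ w^{a−1}(1−w)^{b−1}/(A(w))^{a+b} dw − Γ(1+a)·Γ(1+b). -/
open MeasureTheory Real Filter

theorem lintegral_rpow_mul_exp_neg_mul_Ioi {c k : ℝ} (hc : 0 < c) (hk : 0 < k) :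
    ∫⁻ x in Set.Ioi (0:ℝ), ENNReal.ofReal (x ^ (c - 1) * exp (-(k * x)))
      = ENNReal.ofReal ((1 / k) ^ c * Gamma c) := by
  have h := Real.integral_rpow_mul_exp_neg_mul_Ioi hc hk
  rw [← h, ofReal_integral_eq_lintegral_ofReal]
  · refine not_imp_comm.1 integral_undef ?_
    rw [h]
    have := Gamma_pos_of_pos hc
    positivity
  · filter_upwards [ae_restrict_mem measurableSet_Ioi] with x hx
    have : (0:ℝ) < x := hx
    positivity

theorem lintegral_Ioi_comp_mul_left {x : ℝ} (hx : 0 < x) (g : ℝ → ENNReal) :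
    ∫⁻ y in Set.Ioi (0:ℝ), g y
      = ∫⁻ t in Set.Ioi (0:ℝ), ENNReal.ofReal x * g (x * t) := by
  have himg : (fun t => x * t) '' Set.Ioi (0:ℝ) = Set.Ioi 0 := by
    simpa using Set.image_mul_left_Ioi hx 0
  conv_lhs => rw [← himg]
  rw [lintegral_image_eq_lintegral_abs_deriv_mul (f' := fun _ => x) measurableSet_Ioi
    (fun t _ => by simpa using ((hasDerivAt_id t).const_mul x).hasDerivWithinAt)
    (fun s _ t _ h => mul_left_cancel₀ hx.ne' h)]
  simp [abs_of_pos hx]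

theorem lintegral_Ioi_eq_lintegral_Ioo_inv (g : ℝ → ENNReal) :
    ∫⁻ t in Set.Ioi (0:ℝ), g t
      = ∫⁻ w in Set.Ioo (0:ℝ) 1, ENNReal.ofReal ((w ^ 2)⁻¹) * g (w⁻¹ - 1) := by
  have himg : (fun w : ℝ => w⁻¹ - 1) '' Set.Ioo (0:ℝ) 1 = Set.Ioi 0 := by
    ext t
    simp only [Set.mem_image, Set.mem_Ioo, Set.mem_Ioi]
    constructor
    · rintro ⟨w, ⟨h0, h1⟩, rfl⟩
      have := (one_lt_inv₀ h0).2 h1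
      linarith
    · intro ht
      exact ⟨(1 + t)⁻¹, ⟨by positivity, inv_lt_one_of_one_lt₀ (by linarith)⟩, by simp⟩
  conv_lhs => rw [← himg]
  rw [lintegral_image_eq_lintegral_abs_deriv_mul (f' := fun w => -(w ^ 2)⁻¹) measurableSet_Ioo
    (fun w hw => ((hasDerivAt_inv hw.1.ne').sub_const 1).hasDerivWithinAt)
    (fun s _ t _ h => by simpa using h)]
  simp

/-- Layer cake formula for the joint moments of a pair of nonnegative random variables. -/
theorem lintegral_rpow_mul_rpow_eq_lintegral_meas_lt {Ω : Type*} [MeasurableSpace Ω]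
    (μ : Measure Ω) {S T : Ω → ℝ} (hS : Measurable S) (hT : Measurable T)
    (hS0 : ∀ᵐ ω ∂μ, 0 ≤ S ω) (hT0 : ∀ᵐ ω ∂μ, 0 ≤ T ω) {a b : ℝ} (ha : 0 < a) (hb : 0 < b) :
    ∫⁻ ω, ENNReal.ofReal (S ω ^ a * T ω ^ b) ∂μ
      = ENNReal.ofReal a * ∫⁻ x in Set.Ioi (0:ℝ), (ENNReal.ofReal b *
          ∫⁻ y in Set.Ioi (0:ℝ), μ {ω | x < S ω ∧ y < T ω} * ENNReal.ofReal (y ^ (b - 1)))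
            * ENNReal.ofReal (x ^ (a - 1)) := by
  have hTb : Measurable fun ω => ENNReal.ofReal (T ω ^ b) := by fun_prop
  have hac := withDensity_absolutelyContinuous μ fun ω => ENNReal.ofReal (T ω ^ b)
  have h1 := lintegral_rpow_eq_lintegral_meas_lt_mul
    (μ.withDensity fun ω => ENNReal.ofReal (T ω ^ b)) (hac.ae_le hS0) hS.aemeasurable ha
  rw [lintegral_withDensity_eq_lintegral_mul _ hTb (by fun_prop)] at h1
  have h2 : ∫⁻ ω, ENNReal.ofReal (S ω ^ a * T ω ^ b) ∂μ
      = ∫⁻ ω, ((fun ω => ENNReal.ofReal (T ω ^ b)) * fun ω => ENNReal.ofReal (S ω ^ a)) ω ∂μ := by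
    refine lintegral_congr_ae ?_
    filter_upwards [hT0] with ω hω
    rw [Pi.mul_apply, ← ENNReal.ofReal_mul (by positivity), mul_comm]
  rw [h2, h1]
  congr 1
  refine lintegral_congr fun x => ?_
  congr 1
  rw [withDensity_apply _ (measurableSet_lt measurable_const hS),
    lintegral_rpow_eq_lintegral_meas_lt_mul _ (ae_restrict_of_ae hT0) hT.aemeasurable hb]
  congr 1
  refine lintegral_congr fun y => ?_
  rw [Measure.restrict_apply (measurableSet_lt measurable_const hT)]
  congr 2
  ext ω
  exact and_comm

/-- The moment of a min-stable survival function, written in the coordinates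
`w = x / (x + y)` and `x`. -/
theorem lintegral_rpow_mul_exp_neg_pickands {A : ℝ → ℝ} (hA : ContinuousOn A (Set.Ioo 0 1))
    (hpos : ∀ w ∈ Set.Ioo (0:ℝ) 1, 0 < A w) {a b : ℝ} (ha : 0 < a) (hb : 0 < b) :
    ENNReal.ofReal a * ∫⁻ x in Set.Ioi (0:ℝ), (ENNReal.ofReal b *
        ∫⁻ y in Set.Ioi (0:ℝ), ENNReal.ofReal (exp (-((x + y) * A (x / (x + y)))))
          * ENNReal.ofReal (y ^ (b - 1))) * ENNReal.ofReal (x ^ (a - 1))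
      = ENNReal.ofReal (a * b * Gamma (a + b)) * ∫⁻ w in Set.Ioo (0:ℝ) 1,
          ENNReal.ofReal (w ^ (a - 1) * (1 - w) ^ (b - 1) / A w ^ (a + b)) := by
  classical
  set B : ℝ → ℝ := (Set.Ioo (0:ℝ) 1).piecewise A 1 with hB
  have hBm : Measurable B := hA.measurable_piecewise continuousOn_const measurableSet_Ioo
  have hBA : ∀ w ∈ Set.Ioo (0:ℝ) 1, A w = B w := fun w hw => by
    rw [hB, Set.piecewise_eq_of_mem _ _ _ hw]
  have hG := Gamma_pos_of_pos (add_pos ha hb)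
  have hmem : ∀ t : ℝ, 0 < t → (1 + t)⁻¹ ∈ Set.Ioo (0:ℝ) 1 := fun t ht =>
    ⟨by positivity, inv_lt_one_of_one_lt₀ (by linarith)⟩
  have hinner : ∀ x ∈ Set.Ioi (0:ℝ), (ENNReal.ofReal b *
        ∫⁻ y in Set.Ioi (0:ℝ), ENNReal.ofReal (exp (-((x + y) * A (x / (x + y)))))
          * ENNReal.ofReal (y ^ (b - 1))) * ENNReal.ofReal (x ^ (a - 1))
      = ∫⁻ t in Set.Ioi (0:ℝ), ENNReal.ofReal (b * t ^ (b - 1)) * ENNReal.ofReal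
          (x ^ (a + b - 1) * exp (-((1 + t) * B (1 + t)⁻¹ * x))) := by
    intro x hx
    have hx : 0 < x := hx
    rw [lintegral_Ioi_comp_mul_left hx, ← lintegral_const_mul' _ _ ENNReal.ofReal_ne_top,
      ← lintegral_mul_const' _ _ ENNReal.ofReal_ne_top]
    refine setLIntegral_congr_fun measurableSet_Ioi fun t ht => ?_
    have ht : 0 < t := ht
    have hq : x / (x + x * t) = (1 + t)⁻¹ := by field_simp
    have he : x ^ (a + b - 1) = x * x ^ (b - 1) * x ^ (a - 1) := by
      nth_rewrite 2 [← rpow_one x]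
      rw [← rpow_add hx, ← rpow_add hx]
      ring_nf
    rw [hq, hBA _ (hmem t ht), ← ENNReal.ofReal_mul (by positivity),
      ← ENNReal.ofReal_mul (by positivity), ← ENNReal.ofReal_mul (by positivity),
      ← ENNReal.ofReal_mul (by positivity), ← ENNReal.ofReal_mul (by positivity),
      mul_rpow hx.le ht.le, he]
    ring_nf
  rw [setLIntegral_congr_fun measurableSet_Ioi hinner, lintegral_lintegral_swap (by fun_prop),
    lintegral_Ioi_eq_lintegral_Ioo_inv, ← lintegral_const_mul' _ _ ENNReal.ofReal_ne_top,
    ← lintegral_const_mul' _ _ ENNReal.ofReal_ne_top]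
  refine setLIntegral_congr_fun measurableSet_Ioo fun w hw => ?_
  have hw0 : 0 < w := hw.1
  have hw1 : 0 < 1 - w := sub_pos.2 hw.2
  have hAw : 0 < B w := hBA w hw ▸ hpos w hw
  have hw' : 1 + (w⁻¹ - 1) = w⁻¹ := by ring
  have hpow : (w⁻¹ - 1) ^ (b - 1) = (1 - w) ^ (b - 1) * (w ^ (b - 1))⁻¹ := by
    rw [show w⁻¹ - 1 = (1 - w) / w by field_simp, div_rpow hw1.le hw0.le, div_eq_mul_inv]
  have hk : (1 / (w⁻¹ * B w)) ^ (a + b) = w ^ (a + b) / B w ^ (a + b) := by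
    rw [← div_rpow hw0.le hAw.le]
    congr 1
    field_simp
  have hsplit : w ^ (a + b) = w ^ 2 * w ^ (b - 1) * w ^ (a - 1) := by
    rw [← rpow_natCast w 2, ← rpow_add hw0, ← rpow_add hw0]
    congr 1
    push_cast
    ring
  simp only [hw', inv_inv]
  rw [lintegral_const_mul' _ _ ENNReal.ofReal_ne_top,
    lintegral_rpow_mul_exp_neg_mul_Ioi (add_pos ha hb) (by positivity), hpow, hk, hBA w hw,
    ← ENNReal.ofReal_mul (by positivity), ← ENNReal.ofReal_mul (by positivity),
    ← ENNReal.ofReal_mul (by positivity), ← ENNReal.ofReal_mul (by positivity), hsplit]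
  congr 1
  field_simp

/-- Moments of a nonnegative random variable with the unit exponential survival function. -/
theorem integral_rpow_of_meas_lt_eq_exp_neg {Ω : Type*} [MeasurableSpace Ω]
    (μ : Measure Ω) {X : Ω → ℝ} (hX : Measurable X) (hX0 : ∀ᵐ ω ∂μ, 0 ≤ X ω)
    (hsurv : ∀ x, 0 < x → μ {ω | x < X ω} = ENNReal.ofReal (exp (-x))) {a : ℝ} (ha : 0 < a) :
    ∫ ω, X ω ^ a ∂μ = Gamma (1 + a) := by
  have hG := Gamma_pos_of_pos ha
  have h0 : 0 ≤ᵐ[μ] fun ω => X ω ^ a := by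
    filter_upwards [hX0] with ω hω
    exact rpow_nonneg hω a
  rw [integral_eq_lintegral_of_nonneg_ae h0 (hX.pow_const a).aestronglyMeasurable,
    lintegral_rpow_eq_lintegral_meas_lt_mul μ hX0 hX.aemeasurable ha]
  have h : ∀ x ∈ Set.Ioi (0:ℝ), μ {ω | x < X ω} * ENNReal.ofReal (x ^ (a - 1))
      = ENNReal.ofReal (x ^ (a - 1) * exp (-(1 * x))) := by
    intro x hx
    rw [hsurv x hx, ← ENNReal.ofReal_mul (by positivity), mul_comm, one_mul]
  rw [setLIntegral_congr_fun measurableSet_Ioi h,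
    lintegral_rpow_mul_exp_neg_mul_Ioi ha one_pos, ← ENNReal.ofReal_mul ha.le,
    ENNReal.toReal_ofReal (by positivity), add_comm, Gamma_add_one ha.ne']
  simp

/-- A pair with joint survival function `exp (-y)` along the axis `x = 0` is almost surely
positive. -/
theorem ae_pos_of_meas_lt_eq_exp_neg {Ω : Type*} [MeasurableSpace Ω] (μ : Measure Ω)
    [IsProbabilityMeasure μ] {S T : Ω → ℝ} (hS : Measurable S) (hT : Measurable T)
    (h : ∀ y, 0 < y → μ {ω | 0 < S ω ∧ y < T ω} = ENNReal.ofReal (exp (-y))) :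
    ∀ᵐ ω ∂μ, 0 < S ω ∧ 0 < T ω := by
  have hmeas : MeasurableSet {ω | 0 < S ω ∧ 0 < T ω} :=
    (measurableSet_lt measurable_const hS).inter (measurableSet_lt measurable_const hT)
  refine (mem_ae_iff_prob_eq_one hmeas).2 ?_
  refine le_antisymm prob_le_one ?_
  have hlim : Tendsto (fun y : ℝ => ENNReal.ofReal (exp (-y))) (nhdsWithin 0 (Set.Ioi 0))
      (nhds 1) := by
    have : Continuous fun y : ℝ => ENNReal.ofReal (exp (-y)) :=
      ENNReal.continuous_ofReal.comp (by fun_prop)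
    simpa using (this.tendsto 0).mono_left nhdsWithin_le_nhds
  refine le_of_tendsto hlim ?_
  filter_upwards [self_mem_nhdsWithin] with y hy
  rw [← h y hy]
  exact measure_mono fun ω hω => ⟨hω.1, lt_trans hy hω.2⟩

/-- Let `(S, T)` have a min-stable distribution with unit exponential
margins and Pickands dependence function `A`. Then for all `a, b > 0`,
`E[S^a T^b] = a*b*Γ(a+b) * ∫₀¹ w^(a-1)(1-w)^(b-1) / (A w)^(a+b) dw`, and consequently
`Cov(S^a, T^b)` equals that integral expression minus `Γ(1+a) Γ(1+b)`. -/
theorem minStable_moment_and_cov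
    {Ω : Type*} [MeasurableSpace Ω] (μ : Measure Ω) [IsProbabilityMeasure μ]
    (S T : Ω → ℝ) (hS : Measurable S) (hT : Measurable T)
    (A : ℝ → ℝ)
    (hAconv : ConvexOn ℝ (Set.Icc (0:ℝ) 1) A)
    (hAbound : ∀ w ∈ Set.Icc (0:ℝ) 1, max w (1 - w) ≤ A w ∧ A w ≤ 1)
    (hsurv : ∀ x y : ℝ, 0 ≤ x → 0 ≤ y → (x, y) ≠ (0, 0) →
      (μ {ω | x < S ω ∧ y < T ω}).toReal = Real.exp (-((x + y) * A (x / (x + y)))))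
    (a b : ℝ) (ha : 0 < a) (hb : 0 < b) :
    (∫ ω, S ω ^ a * T ω ^ b ∂μ)
        = a * b * Real.Gamma (a + b)
            * ∫ w in (0:ℝ)..1, w ^ (a - 1) * (1 - w) ^ (b - 1) / (A w) ^ (a + b)
      ∧
    (∫ ω, S ω ^ a * T ω ^ b ∂μ) - (∫ ω, S ω ^ a ∂μ) * (∫ ω, T ω ^ b ∂μ)
        = a * b * Real.Gamma (a + b)
            * (∫ w in (0:ℝ)..1, w ^ (a - 1) * (1 - w) ^ (b - 1) / (A w) ^ (a + b))
          - Real.Gamma (1 + a) * Real.Gamma (1 + b) := by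
  have hA0 : A 0 = 1 := by
    have h := hAbound 0 (by simp)
    exact le_antisymm h.2 (by simpa using (le_max_right (0:ℝ) (1 - 0)).trans h.1)
  have hA1 : A 1 = 1 := by
    have h := hAbound 1 (by simp)
    exact le_antisymm h.2 (by simpa using (le_max_left (1:ℝ) (1 - 1)).trans h.1)
  have hpos : ∀ w ∈ Set.Ioo (0:ℝ) 1, 0 < A w := fun w hw =>
    hw.1.trans_le ((le_max_left _ _).trans (hAbound w (Set.Ioo_subset_Icc_self hw)).1)
  have hAcont : ContinuousOn A (Set.Ioo 0 1) := by
    simpa [interior_Icc] using hAconv.continuousOn_interior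
  have hmeas : ∀ x y : ℝ, 0 ≤ x → 0 ≤ y → (x, y) ≠ (0, 0) →
      μ {ω | x < S ω ∧ y < T ω} = ENNReal.ofReal (exp (-((x + y) * A (x / (x + y))))) :=
    fun x y hx hy hxy => by
      rw [← hsurv x y hx hy hxy, ENNReal.ofReal_toReal (measure_ne_top _ _)]
  have hae : ∀ᵐ ω ∂μ, 0 < S ω ∧ 0 < T ω := by
    refine ae_pos_of_meas_lt_eq_exp_neg μ hS hT fun y hy => ?_
    rw [hmeas 0 y le_rfl hy.le (by simp [hy.ne'])]
    simp [hA0]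
  have hS0 : ∀ᵐ ω ∂μ, 0 ≤ S ω := hae.mono fun ω h => h.1.le
  have hT0 : ∀ᵐ ω ∂μ, 0 ≤ T ω := hae.mono fun ω h => h.2.le
  have hmS : ∫ ω, S ω ^ a ∂μ = Gamma (1 + a) := by
    refine integral_rpow_of_meas_lt_eq_exp_neg μ hS hS0 (fun x hx => ?_) ha
    have h := hmeas x 0 hx.le le_rfl (by simp [hx.ne'])
    rw [add_zero, div_self hx.ne', hA1, mul_one] at h
    rw [← h]
    exact measure_congr (hae.mono fun ω hω => propext (iff_self_and.2 fun _ => hω.2))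
  have hmT : ∫ ω, T ω ^ b ∂μ = Gamma (1 + b) := by
    refine integral_rpow_of_meas_lt_eq_exp_neg μ hT hT0 (fun y hy => ?_) hb
    have h := hmeas 0 y le_rfl hy.le (by simp [hy.ne'])
    rw [zero_add, zero_div, hA0, mul_one] at h
    rw [← h]
    exact measure_congr (hae.mono fun ω hω => propext (iff_and_self.2 fun _ => hω.1))
  have hmain : ∫ ω, S ω ^ a * T ω ^ b ∂μ
      = a * b * Gamma (a + b)
          * ∫ w in (0:ℝ)..1, w ^ (a - 1) * (1 - w) ^ (b - 1) / (A w) ^ (a + b) := by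
    have hG := Gamma_pos_of_pos (add_pos ha hb)
    have h0 : 0 ≤ᵐ[μ] fun ω => S ω ^ a * T ω ^ b := by
      filter_upwards [hae] with ω hω
      exact mul_nonneg (rpow_nonneg hω.1.le a) (rpow_nonneg hω.2.le b)
    have h1 : 0 ≤ᵐ[volume.restrict (Set.Ioo (0:ℝ) 1)]
        fun w => w ^ (a - 1) * (1 - w) ^ (b - 1) / (A w) ^ (a + b) := by
      filter_upwards [ae_restrict_mem measurableSet_Ioo] with w hw
      exact div_nonneg (mul_nonneg (rpow_nonneg hw.1.le _) (rpow_nonneg (sub_pos.2 hw.2).le _))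
        (rpow_nonneg (hpos w hw).le _)
    have hAm : AEMeasurable A (volume.restrict (Set.Ioo (0:ℝ) 1)) :=
      hAcont.aemeasurable measurableSet_Ioo
    have hm : AEMeasurable (fun w => w ^ (a - 1) * (1 - w) ^ (b - 1) / (A w) ^ (a + b))
        (volume.restrict (Set.Ioo (0:ℝ) 1)) := by fun_prop
    have hmom := lintegral_rpow_mul_rpow_eq_lintegral_meas_lt μ hS hT hS0 hT0 ha hb
    have hcongr : ∀ x ∈ Set.Ioi (0:ℝ), (ENNReal.ofReal b *
          ∫⁻ y in Set.Ioi (0:ℝ), μ {ω | x < S ω ∧ y < T ω} * ENNReal.ofReal (y ^ (b - 1)))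
            * ENNReal.ofReal (x ^ (a - 1))
        = (ENNReal.ofReal b *
          ∫⁻ y in Set.Ioi (0:ℝ), ENNReal.ofReal (exp (-((x + y) * A (x / (x + y)))))
            * ENNReal.ofReal (y ^ (b - 1))) * ENNReal.ofReal (x ^ (a - 1)) := by
      intro x hx
      congr 2
      refine setLIntegral_congr_fun measurableSet_Ioi fun y hy => ?_
      have hx : 0 < x := hx
      have hy : 0 < y := hy
      rw [hmeas x y hx.le hy.le (by simp [hx.ne'])]
    rw [setLIntegral_congr_fun measurableSet_Ioi hcongr,
      lintegral_rpow_mul_exp_neg_pickands hAcont hpos ha hb] at hmom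
    rw [integral_eq_lintegral_of_nonneg_ae h0 (by fun_prop), hmom,
      intervalIntegral.integral_of_le zero_le_one, integral_Ioc_eq_integral_Ioo,
      integral_eq_lintegral_of_nonneg_ae h1 hm.aestronglyMeasurable, ENNReal.toReal_mul,
      ENNReal.toReal_ofReal (by positivity)]
  exact ⟨hmain, by rw [hmain, hmS, hmT]⟩
end

section
/- Let (S, T) have a min-stable distribution with unit exponential margins and Pickands dependence function A. Then for all a > 0, H_{0,1}(a,0) = Cov(S^a, log T) = ∫₀¹ Γ(a+1)·((A(w))^{−a} − 1)·w^{a−1}·(1−w)^{−1} dw. -/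
open MeasureTheory Real Filter

open ProbabilityTheory

/-- Polar-type change of variables `(x, y) = (r w, r (1 - w))` on the positive quadrant. -/
lemma lintegral_lintegral_Ioi_eq_simplex {f : ℝ → ℝ → ENNReal}
    (hf : Measurable (Function.uncurry f)) :
    ∫⁻ y in Set.Ioi 0, ∫⁻ x in Set.Ioi 0, f x y
      = ∫⁻ w in Set.Ioo 0 1, ∫⁻ r in Set.Ioi 0,
          ENNReal.ofReal r * f (r * w) (r * (1 - w)) := by
  have hF : Measurable fun p : ℝ × ℝ ↦
      (Set.Ioo 0 p.1).indicator (fun y ↦ f (p.1 - y) y) p.2 := by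
    have : (fun p : ℝ × ℝ ↦ (Set.Ioo 0 p.1).indicator (fun y ↦ f (p.1 - y) y) p.2)
        = {p : ℝ × ℝ | 0 < p.2 ∧ p.2 < p.1}.indicator (fun p ↦ f (p.1 - p.2) p.2) := by
      ext p
      simp [Set.indicator, Set.mem_Ioo]
    rw [this]
    refine (hf.comp (f := fun p : ℝ × ℝ ↦ (p.1 - p.2, p.2)) (by fun_prop)).indicator ?_
    exact (measurableSet_lt measurable_const measurable_snd).inter
      (measurableSet_lt measurable_snd measurable_fst)
  have hx (y : ℝ) (hy : 0 < y) : ∫⁻ x in Set.Ioi 0, f x y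
      = ∫⁻ r in Set.Ioi 0, (Set.Ioo 0 r).indicator (fun y ↦ f (r - y) y) y := by
    rw [← lintegral_indicator measurableSet_Ioi, ← lintegral_indicator measurableSet_Ioi,
      ← lintegral_sub_right_eq_self _ y]
    refine lintegral_congr fun r ↦ ?_
    by_cases h : y < r
    · simp [Set.indicator, h, hy, hy.trans h]
    · simp [Set.indicator, h]
  have hy (r : ℝ) (hr : 0 < r) :
      ∫⁻ y in Set.Ioi 0, (Set.Ioo 0 r).indicator (fun y ↦ f (r - y) y) y
        = ∫⁻ w in Set.Ioo 0 1, ENNReal.ofReal r * f (r * w) (r * (1 - w)) := by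
    have himage : Set.Ioo 0 r = (fun w ↦ r * (1 - w)) '' Set.Ioo 0 1 := by
      ext y
      simp only [Set.mem_image, Set.mem_Ioo]
      constructor
      · rintro ⟨h0, h1⟩
        refine ⟨1 - y / r, ⟨?_, ?_⟩, by field_simp; ring⟩
        · rw [sub_pos, div_lt_one hr]; exact h1
        · have := div_pos h0 hr; linarith
      · rintro ⟨w, ⟨h0, h1⟩, rfl⟩
        exact ⟨by nlinarith, by nlinarith⟩
    have hder (w : ℝ) : HasDerivAt (fun w ↦ r * (1 - w)) (-r) w := by
      simpa using ((hasDerivAt_id w).const_sub 1).const_mul r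
    rw [lintegral_indicator measurableSet_Ioo, Measure.restrict_restrict measurableSet_Ioo,
      Set.inter_eq_left.2 Set.Ioo_subset_Ioi_self, himage,
      lintegral_image_eq_lintegral_abs_deriv_mul measurableSet_Ioo
        (fun w _ ↦ (hder w).hasDerivWithinAt)
        (fun u _ v _ h ↦ by simpa [hr.ne'] using h)]
    refine lintegral_congr fun w ↦ ?_
    rw [abs_neg, abs_of_pos hr]
    congr 2
    ring
  rw [setLIntegral_congr_fun measurableSet_Ioi hx, lintegral_lintegral_swap,
    setLIntegral_congr_fun measurableSet_Ioi hy, lintegral_lintegral_swap]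
  · refine Measurable.aemeasurable ?_
    exact Measurable.mul (by fun_prop)
      (hf.comp (f := fun p : ℝ × ℝ ↦ (p.1 * p.2, p.1 * (1 - p.2))) (by fun_prop))
  · exact (hF.comp measurable_swap).aemeasurable

/-- The kernel with `log t = ∫ y in Ioi 0, logKernel t y` for `t > 0`. -/
noncomputable def logKernel (t y : ℝ) : ℝ :=
  ((if y < t then 1 else 0) - (if y < 1 then 1 else 0)) * y⁻¹

lemma measurable_uncurry_logKernel : Measurable (Function.uncurry logKernel) := by
  unfold logKernel
  refine Measurable.mul (Measurable.sub ?_ ?_) (by fun_prop)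
  · exact Measurable.ite (measurableSet_lt measurable_snd measurable_fst) (by fun_prop)
      (by fun_prop)
  · exact Measurable.ite (measurableSet_lt measurable_snd measurable_const) (by fun_prop)
      (by fun_prop)

lemma integrableOn_inv_Ico {a b : ℝ} (ha : 0 < a) : IntegrableOn (fun y : ℝ ↦ y⁻¹) (Set.Ico a b) :=
  ((continuousOn_inv₀.mono fun _ hy ↦ (ha.trans_le hy.1).ne').integrableOn_Icc).mono_set
    Set.Ico_subset_Icc_self

lemma integral_indicator_Ico_inv {a b : ℝ} (ha : 0 < a) (hab : a ≤ b) :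
    ∫ y in Set.Ioi 0, (Set.Ico a b).indicator (fun y ↦ y⁻¹) y = log b - log a := by
  rw [integral_indicator measurableSet_Ico, Measure.restrict_restrict measurableSet_Ico,
    Set.inter_eq_left.2 (show Set.Ico a b ⊆ Set.Ioi 0 from fun y hy ↦ ha.trans_le hy.1),
    integral_Ico_eq_integral_Ioc,
    ← intervalIntegral.integral_of_le hab, integral_inv_of_pos ha (ha.trans_le hab),
    log_div (ha.trans_le hab).ne' ha.ne']

lemma logKernel_of_one_le {t : ℝ} (ht : 1 ≤ t) :
    logKernel t = (Set.Ico 1 t).indicator (fun y ↦ y⁻¹) := by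
  ext y
  by_cases h1 : y < t <;> by_cases h2 : y < 1 <;> simp [logKernel, Set.indicator, h1, h2]
  linarith

lemma logKernel_of_le_one {t : ℝ} (ht : t ≤ 1) :
    logKernel t = -(Set.Ico t 1).indicator (fun y ↦ y⁻¹) := by
  ext y
  by_cases h1 : y < t <;> by_cases h2 : y < 1 <;>
    simp [logKernel, Set.indicator, h1, h2]
  linarith

lemma integrableOn_logKernel {t : ℝ} (ht : 0 < t) : IntegrableOn (logKernel t) (Set.Ioi 0) := by
  rcases le_total 1 t with h | h
  · rw [logKernel_of_one_le h]
    exact ((integrableOn_inv_Ico one_pos).integrable_indicator measurableSet_Ico).integrableOn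
  · rw [logKernel_of_le_one h]
    exact ((integrableOn_inv_Ico ht).integrable_indicator measurableSet_Ico).integrableOn.neg

lemma integral_logKernel {t : ℝ} (ht : 0 < t) : ∫ y in Set.Ioi 0, logKernel t y = log t := by
  rcases le_total 1 t with h | h
  · rw [logKernel_of_one_le h, integral_indicator_Ico_inv one_pos h]
    simp
  · simp_rw [logKernel_of_le_one h, Pi.neg_apply]
    rw [integral_neg, integral_indicator_Ico_inv ht h]
    simp

lemma integral_abs_logKernel {t : ℝ} (ht : 0 < t) :
    ∫ y in Set.Ioi 0, |logKernel t y| = |log t| := by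
  have hnn {b c y : ℝ} (hb : 0 < b) : 0 ≤ (Set.Ico b c).indicator (fun y ↦ y⁻¹) y :=
    Set.indicator_nonneg (fun y hy ↦ inv_nonneg.2 (hb.le.trans hy.1)) y
  rcases le_total 1 t with h | h
  · rw [logKernel_of_one_le h, abs_of_nonneg (log_nonneg h)]
    simp_rw [abs_of_nonneg (hnn one_pos)]
    rw [integral_indicator_Ico_inv one_pos h]
    simp
  · simp_rw [logKernel_of_le_one h, abs_of_nonpos (log_nonpos ht.le h), Pi.neg_apply, abs_neg,
      abs_of_nonneg (hnn ht)]
    rw [integral_indicator_Ico_inv ht h]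
    simp

lemma integral_mul_log_eq_integral_logKernel {Ω : Type*} [MeasurableSpace Ω] {μ : Measure Ω}
    [IsFiniteMeasure μ] {X T : Ω → ℝ} (hX : Measurable X) (hT : Measurable T)
    (hTpos : ∀ᵐ ω ∂μ, 0 < T ω) (hInt : Integrable (fun ω ↦ X ω * log (T ω)) μ) :
    ∫ ω, X ω * log (T ω) ∂μ = ∫ y in Set.Ioi 0, ∫ ω, X ω * logKernel (T ω) y ∂μ := by
  have hmeas : Measurable (Function.uncurry fun ω y ↦ X ω * logKernel (T ω) y) :=
    Measurable.mul (by fun_prop) (measurable_uncurry_logKernel.comp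
      (f := fun p : Ω × ℝ ↦ (T p.1, p.2)) (by fun_prop))
  rw [← integral_integral_swap]
  · refine integral_congr_ae ?_
    filter_upwards [hTpos] with ω hω
    rw [integral_const_mul, integral_logKernel hω]
  · rw [integrable_prod_iff hmeas.aestronglyMeasurable]
    constructor
    · filter_upwards [hTpos] with ω hω
      exact (integrableOn_logKernel hω).const_mul (X ω)
    · refine hInt.norm.congr ?_
      filter_upwards [hTpos] with ω hω
      simp only [Function.uncurry, norm_mul, Real.norm_eq_abs]
      rw [integral_const_mul, integral_abs_logKernel hω]

lemma ae_pos_of_exp_neg_le_measureReal {Ω : Type*} [MeasurableSpace Ω] {μ : Measure Ω}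
    [IsProbabilityMeasure μ] {T : Ω → ℝ} (hT : Measurable T)
    (h : ∀ x > 0, exp (-x) ≤ μ.real {ω | 0 < T ω}) : ∀ᵐ ω ∂μ, 0 < T ω := by
  have hlim : Tendsto (fun x : ℝ ↦ exp (-x)) (nhdsWithin 0 (Set.Ioi 0)) (nhds 1) := by
    have : Continuous fun x : ℝ ↦ exp (-x) := by fun_prop
    simpa using (this.tendsto 0).mono_left nhdsWithin_le_nhds
  have h1 : 1 ≤ μ.real {ω | 0 < T ω} :=
    le_of_tendsto hlim (eventually_nhdsWithin_of_forall h)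
  have hs : MeasurableSet {ω | 0 < T ω} := measurableSet_lt measurable_const hT
  have h2 : μ {ω | 0 < T ω} = 1 := by
    rw [← ENNReal.toReal_eq_one_iff]
    exact le_antisymm measureReal_le_one h1
  exact (mem_ae_iff_prob_eq_one hs).2 h2

lemma map_eq_expMeasure_one {Ω : Type*} [MeasurableSpace Ω] {μ : Measure Ω}
    [IsProbabilityMeasure μ] {T : Ω → ℝ} (hT : Measurable T)
    (h : ∀ y ≥ 0, μ.real {ω | y < T ω} = exp (-y)) : μ.map T = expMeasure 1 := by
  have := Measure.isProbabilityMeasure_map (μ := μ) hT.aemeasurable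
  have := isProbabilityMeasure_expMeasure one_pos
  refine Measure.eq_of_cdf _ _ ?_
  ext x
  have key : cdf (μ.map T) x = 1 - μ.real {ω | x < T ω} := by
    rw [cdf_eq_real, map_measureReal_apply hT measurableSet_Iic,
      ← probReal_compl_eq_one_sub (measurableSet_lt measurable_const hT)]
    congr 1
    ext ω
    simp
  rw [cdf_expMeasure_eq one_pos, key]
  split_ifs with hx
  · rw [h x hx, one_mul]
  · have h0 := h 0 le_rfl
    have : μ.real {ω | 0 < T ω} ≤ μ.real {ω | x < T ω} :=
      measureReal_mono fun ω hω ↦ (not_le.1 hx).trans hω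
    have h1 : μ.real {ω | x < T ω} ≤ 1 := measureReal_le_one
    simp at h0
    linarith

lemma integrable_rpow_expMeasure_one {p : ℝ} (hp : -1 < p) :
    Integrable (fun t : ℝ ↦ t ^ p) (expMeasure 1) := by
  have : expMeasure 1 = volume.withDensity fun x ↦ ENNReal.ofReal (exponentialPDFReal 1 x) := rfl
  rw [this, integrable_withDensity_iff (by fun_prop)
    (ae_of_all _ fun x ↦ ENNReal.ofReal_lt_top)]
  have h := integrableOn_rpow_mul_exp_neg_mul_rpow hp one_pos one_pos
  rw [← integrableOn_Ici_iff_integrableOn_Ioi, ← integrable_indicator_iff measurableSet_Ici] at h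
  refine h.congr (ae_of_all _ fun x ↦ ?_)
  by_cases hx : 0 ≤ x
  · simp [exponentialPDFReal, gammaPDFReal, hx, (exp_pos _).le]
  · simp [exponentialPDFReal, gammaPDFReal, hx]

lemma sq_log_le {t : ℝ} (ht : 0 < t) :
    log t ^ 2 ≤ 32 * (t ^ (1 / 2 : ℝ) + t ^ (-1 / 2 : ℝ)) := by
  have h1 := log_le_rpow_div ht.le (ε := 1 / 4) (by norm_num)
  have h2 := log_le_rpow_div (inv_pos.2 ht).le (ε := 1 / 4) (by norm_num)
  rw [log_inv, inv_rpow ht.le, ← rpow_neg ht.le] at h2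
  have e1 : t ^ (1 / 2 : ℝ) = (t ^ (1 / 4 : ℝ)) ^ 2 := by
    rw [← rpow_natCast, ← rpow_mul ht.le]; norm_num
  have e2 : t ^ (-1 / 2 : ℝ) = (t ^ (-(1 / 4) : ℝ)) ^ 2 := by
    rw [← rpow_natCast, ← rpow_mul ht.le]; norm_num
  have p1 : 0 < t ^ (1 / 4 : ℝ) := rpow_pos_of_pos ht _
  have p2 : 0 < t ^ (-(1 / 4) : ℝ) := rpow_pos_of_pos ht _
  rw [e1, e2]
  have := sq_le_sq' (a := log t) (b := 4 * (t ^ (1 / 4 : ℝ) + t ^ (-(1 / 4) : ℝ)))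
    (by linarith) (by linarith)
  nlinarith [sq_nonneg (t ^ (1 / 4 : ℝ) - t ^ (-(1 / 4) : ℝ))]

lemma lintegral_simplex_radial {a w α : ℝ} (ha : 0 < a) (hw : w ∈ Set.Ioo (0 : ℝ) 1) (hα : 0 < α)
    (hα1 : α ≤ 1) :
    ∫⁻ r in Set.Ioi 0, ENNReal.ofReal r * ENNReal.ofReal
        (a * (r * w) ^ (a - 1) * (r * (1 - w))⁻¹ * (exp (-(r * α)) - exp (-r)))
      = ENNReal.ofReal (Gamma (a + 1) * (α ^ (-a) - 1) * w ^ (a - 1) * (1 - w) ^ (-1 : ℝ)) := by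
  obtain ⟨hw0, hw1⟩ := hw
  have hw1' : 0 < 1 - w := sub_pos.2 hw1
  have hInt {b : ℝ} (hb : 0 < b) :
      IntegrableOn (fun r : ℝ ↦ r ^ (a - 1) * exp (-(b * r))) (Set.Ioi 0) := by
    simpa using integrableOn_rpow_mul_exp_neg_mul_rpow (s := a - 1) (by linarith) one_pos hb
  have hpt : Set.EqOn (fun r : ℝ ↦ ENNReal.ofReal r * ENNReal.ofReal
      (a * (r * w) ^ (a - 1) * (r * (1 - w))⁻¹ * (exp (-(r * α)) - exp (-r))))
      (fun r ↦ ENNReal.ofReal (a * w ^ (a - 1) * (1 - w)⁻¹ *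
        (r ^ (a - 1) * exp (-(α * r)) - r ^ (a - 1) * exp (-(1 * r))))) (Set.Ioi 0) := by
    intro r hr
    have hr : 0 < r := hr
    simp only
    rw [← ENNReal.ofReal_mul hr.le, mul_rpow hr.le hw0.le, one_mul, mul_comm α r]
    congr 1
    field_simp
  rw [setLIntegral_congr_fun measurableSet_Ioi hpt, ← ofReal_integral_eq_lintegral_ofReal,
    integral_const_mul, integral_sub (hInt hα) (hInt one_pos),
    integral_rpow_mul_exp_neg_mul_Ioi ha hα, integral_rpow_mul_exp_neg_mul_Ioi ha one_pos,
    Gamma_add_one ha.ne', rpow_neg_one, one_div, inv_rpow hα.le, rpow_neg hα.le]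
  · congr 1
    simp
    ring
  · exact ((hInt hα).sub (hInt one_pos)).const_mul _
  · filter_upwards [ae_restrict_mem measurableSet_Ioi] with r hr
    have hr : 0 < r := hr
    have : exp (-(1 * r)) ≤ exp (-(α * r)) := exp_le_exp.2 (by nlinarith)
    have := rpow_pos_of_pos hr (a - 1)
    have := rpow_pos_of_pos hw0 (a - 1)
    rw [← mul_sub]
    simp only [Pi.zero_apply]
    have : 0 ≤ exp (-(α * r)) - exp (-(1 * r)) := by linarith
    positivity

lemma integrable_mul_of_sq {Ω : Type*} [MeasurableSpace Ω] {μ : Measure Ω} {f g : Ω → ℝ}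
    (hf : AEStronglyMeasurable f μ) (hg : AEStronglyMeasurable g μ)
    (hf2 : Integrable (fun ω ↦ f ω ^ 2) μ) (hg2 : Integrable (fun ω ↦ g ω ^ 2) μ) :
    Integrable (fun ω ↦ f ω * g ω) μ :=
  ((memLp_two_iff_integrable_sq hf).2 hf2).integrable_mul ((memLp_two_iff_integrable_sq hg).2 hg2)

/-- Layer cake formula for `S ^ a` on the event `y < T`. -/
lemma ofReal_setIntegral_rpow {Ω : Type*} [MeasurableSpace Ω] {μ : Measure Ω}
    [IsFiniteMeasure μ] {S T : Ω → ℝ} (hS : Measurable S) (hT : Measurable T)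
    (hSpos : ∀ᵐ ω ∂μ, 0 < S ω) {a : ℝ} (ha : 0 < a) (hInt : Integrable (fun ω ↦ S ω ^ a) μ)
    (y : ℝ) :
    ENNReal.ofReal (∫ ω in {ω | y < T ω}, S ω ^ a ∂μ)
      = ∫⁻ x in Set.Ioi 0,
          ENNReal.ofReal (a * x ^ (a - 1) * μ.real {ω | x < S ω ∧ y < T ω}) := by
  have hm : MeasurableSet {ω | y < T ω} := measurableSet_lt measurable_const hT
  have hpos : ∀ᵐ ω ∂μ.restrict {ω | y < T ω}, 0 < S ω := ae_restrict_of_ae hSpos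
  rw [ofReal_integral_eq_lintegral_ofReal hInt.integrableOn
      (hpos.mono fun ω hω ↦ rpow_nonneg hω.le a),
    lintegral_rpow_eq_lintegral_meas_lt_mul _ (hpos.mono fun ω hω ↦ hω.le) hS.aemeasurable ha,
    ← lintegral_const_mul' _ _ ENNReal.ofReal_ne_top]
  refine setLIntegral_congr_fun measurableSet_Ioi fun x hx ↦ ?_
  have hx : 0 < x := hx
  have := rpow_pos_of_pos hx (a - 1)
  rw [Measure.restrict_apply (measurableSet_lt measurable_const hS),
    ENNReal.ofReal_mul (by positivity), ENNReal.ofReal_mul ha.le, ofReal_measureReal, mul_assoc,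
    mul_comm (μ _)]
  rfl

lemma measureReal_lt_eq_exp_neg {Ω : Type*} [MeasurableSpace Ω] {μ : Measure Ω}
    [IsProbabilityMeasure μ] {S T : Ω → ℝ} (hSpos : ∀ᵐ ω ∂μ, 0 < S ω) (hTpos : ∀ᵐ ω ∂μ, 0 < T ω)
    (h : ∀ x > 0, μ.real {ω | x < S ω ∧ 0 < T ω} = exp (-x)) (x : ℝ) (hx : 0 ≤ x) :
    μ.real {ω | x < S ω} = exp (-x) := by
  rcases hx.eq_or_lt with rfl | hx
  · rw [measureReal_congr (t := Set.univ)
      (eventuallyEq_set.2 (hSpos.mono fun ω hω ↦ by simpa using hω))]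
    simp
  · rw [← h x hx]
    refine measureReal_congr (eventuallyEq_set.2 ?_)
    filter_upwards [hTpos] with ω hω
    simp [hω]

theorem minStable_cov_rpow_log
    {Ω : Type*} [MeasurableSpace Ω] (μ : Measure Ω) [IsProbabilityMeasure μ]
    (S T : Ω → ℝ) (hS : Measurable S) (hT : Measurable T)
    (A : ℝ → ℝ)
    (hAconv : ConvexOn ℝ (Set.Icc (0:ℝ) 1) A)
    (hAbound : ∀ w ∈ Set.Icc (0:ℝ) 1, max w (1 - w) ≤ A w ∧ A w ≤ 1)
    (hsurv : ∀ x y : ℝ, 0 ≤ x → 0 ≤ y → (x, y) ≠ (0, 0) →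
      (μ {ω | x < S ω ∧ y < T ω}).toReal = Real.exp (-((x + y) * A (x / (x + y)))))
    (a : ℝ) (ha : 0 < a) :
    (∫ ω, S ω ^ a * Real.log (T ω) ∂μ)
        - (∫ ω, S ω ^ a ∂μ) * (∫ ω, Real.log (T ω) ∂μ)
      = ∫ w in (0:ℝ)..1,
          Real.Gamma (a + 1) * ((A w) ^ (-a) - 1) * w ^ (a - 1) * (1 - w) ^ (-1 : ℝ) := by
  have hsurv (x y : ℝ) (hx : 0 ≤ x) (hy : 0 ≤ y) (hxy : 0 < x + y) :
      μ.real {ω | x < S ω ∧ y < T ω} = exp (-((x + y) * A (x / (x + y)))) :=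
    hsurv x y hx hy fun h ↦ by simp_all
  have hA0 : A 0 = 1 := by
    have := hAbound 0 (by simp)
    simp at this
    linarith
  have hA1 : A 1 = 1 := by
    have := hAbound 1 (by simp)
    simp at this
    linarith
  have hsurvS (x : ℝ) (hx : 0 < x) : μ.real {ω | x < S ω ∧ 0 < T ω} = exp (-x) := by
    simp [hsurv x 0 hx.le le_rfl (by linarith), hx.ne', hA1]
  have hsurvT (y : ℝ) (hy : 0 < y) : μ.real {ω | 0 < S ω ∧ y < T ω} = exp (-y) := by
    simp [hsurv 0 y le_rfl hy.le (by linarith), hA0]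
  have hTpos : ∀ᵐ ω ∂μ, 0 < T ω := ae_pos_of_exp_neg_le_measureReal hT fun x hx ↦
    (hsurvS x hx).symm.le.trans (measureReal_mono fun ω hω ↦ hω.2)
  have hSpos : ∀ᵐ ω ∂μ, 0 < S ω := ae_pos_of_exp_neg_le_measureReal hS fun y hy ↦
    (hsurvT y hy).symm.le.trans (measureReal_mono fun ω hω ↦ hω.1)
  have hStail := measureReal_lt_eq_exp_neg hSpos hTpos hsurvS
  have hTtail := measureReal_lt_eq_exp_neg hTpos hSpos
    fun y hy ↦ by simpa only [and_comm] using hsurvT y hy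
  have hSrpow {p : ℝ} (hp : -1 < p) : Integrable (fun ω ↦ S ω ^ p) μ := by
    have := integrable_rpow_expMeasure_one hp
    rw [← map_eq_expMeasure_one hS hStail] at this
    exact this.comp_measurable hS
  have hTrpow {p : ℝ} (hp : -1 < p) : Integrable (fun ω ↦ T ω ^ p) μ := by
    have := integrable_rpow_expMeasure_one hp
    rw [← map_eq_expMeasure_one hT hTtail] at this
    exact this.comp_measurable hT
  have hlog2 : Integrable (fun ω ↦ log (T ω) ^ 2) μ := by
    refine Integrable.mono' (((hTrpow (p := 1 / 2) (by norm_num)).add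
      (hTrpow (p := -1 / 2) (by norm_num))).const_mul 32)
      (hT.log.pow_const 2).aestronglyMeasurable ?_
    filter_upwards [hTpos] with ω hω
    rw [Real.norm_of_nonneg (sq_nonneg _)]
    exact sq_log_le hω
  have hlog : Integrable (fun ω ↦ log (T ω)) μ := by
    simpa using integrable_mul_of_sq (f := fun _ ↦ (1 : ℝ)) (by fun_prop)
      (hT.log.aestronglyMeasurable) (by simp) hlog2
  have hSa : Integrable (fun ω ↦ S ω ^ a) μ := hSrpow (by linarith)
  have hSlog : Integrable (fun ω ↦ S ω ^ a * log (T ω)) μ := by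
    refine integrable_mul_of_sq hSa.aestronglyMeasurable hlog.aestronglyMeasurable ?_ hlog2
    refine (hSrpow (p := a * 2) (by linarith)).congr ?_
    filter_upwards [hSpos] with ω hω
    rw [rpow_mul hω.le, rpow_two]
  set c := ∫ ω, S ω ^ a ∂μ with hc
  have hc0 : 0 ≤ c := integral_nonneg_of_ae (hSpos.mono fun ω hω ↦ rpow_nonneg hω.le a)
  have hInt : Integrable (fun ω ↦ (S ω ^ a - c) * log (T ω)) μ := by
    simp_rw [sub_mul]
    exact hSlog.sub (hlog.const_mul c)
  have hLHS : ∫ ω, S ω ^ a * log (T ω) ∂μ - c * ∫ ω, log (T ω) ∂μ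
      = ∫ y in Set.Ioi 0, ∫ ω, (S ω ^ a - c) * logKernel (T ω) y ∂μ := by
    rw [← integral_mul_log_eq_integral_logKernel (by fun_prop) hT hTpos hInt,
      ← integral_const_mul, ← integral_sub hSlog (hlog.const_mul c)]
    simp_rw [sub_mul]
  have hTm (y : ℝ) : MeasurableSet {ω | y < T ω} := measurableSet_lt measurable_const hT
  have hinner (y : ℝ) (hy : 0 < y) : ∫ ω, (S ω ^ a - c) * logKernel (T ω) y ∂μ
      = y⁻¹ * (∫ ω in {ω | y < T ω}, S ω ^ a ∂μ - c * exp (-y)) := by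
    have hX : Integrable (fun ω ↦ S ω ^ a - c) μ := hSa.sub (integrable_const c)
    have hXint : ∫ ω, (S ω ^ a - c) ∂μ = 0 := by
      rw [integral_sub hSa (integrable_const c)]
      simp [hc]
    have heq : ∀ ω, (S ω ^ a - c) * logKernel (T ω) y
        = y⁻¹ * ({ω | y < T ω}.indicator (fun ω ↦ S ω ^ a - c) ω
          - (if y < 1 then 1 else 0) * (S ω ^ a - c)) := by
      intro ω
      simp only [logKernel, Set.indicator, Set.mem_ofPred_eq]
      split_ifs <;> ring
    simp_rw [heq]
    rw [integral_const_mul, integral_sub (hX.indicator (hTm y)) (hX.const_mul _),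
      integral_const_mul, hXint, integral_indicator (hTm y),
      integral_sub hSa.integrableOn (integrable_const c), setIntegral_const, hTtail y hy.le]
    simp [mul_comm]
  set B := (Set.Ioo (0 : ℝ) 1).indicator A with hB
  have hBmeas : Measurable B := by
    have hcont : ContinuousOn A (Set.Ioo 0 1) := by
      simpa using hAconv.continuousOn_interior
    have := hcont.measurable_piecewise continuous_zero.continuousOn
      (measurableSet_Ioo (a := (0 : ℝ)) (b := 1))
    rwa [Set.piecewise_eq_indicator] at this
  let f : ℝ → ℝ → ENNReal := fun x y ↦ ENNReal.ofReal
    (a * x ^ (a - 1) * y⁻¹ * (exp (-((x + y) * B (x / (x + y)))) - exp (-(x + y))))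
  have hf : Measurable (Function.uncurry f) := by
    unfold f
    fun_prop
  have hAexp (x y : ℝ) (hx : 0 < x) (hy : 0 < y) :
      B (x / (x + y)) = A (x / (x + y)) ∧ A (x / (x + y)) ≤ 1 := by
    have hmem : x / (x + y) ∈ Set.Ioo (0 : ℝ) 1 :=
      ⟨by positivity, by rw [div_lt_one (by positivity)]; linarith⟩
    exact ⟨Set.indicator_of_mem hmem A, (hAbound _ (Set.Ioo_subset_Icc_self hmem)).2⟩
  have hlint (y : ℝ) (hy : 0 < y) :
      0 ≤ y⁻¹ * (∫ ω in {ω | y < T ω}, S ω ^ a ∂μ - c * exp (-y)) ∧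
      ENNReal.ofReal (y⁻¹ * (∫ ω in {ω | y < T ω}, S ω ^ a ∂μ - c * exp (-y)))
        = ∫⁻ x in Set.Ioi 0, f x y := by
    have hp := ofReal_setIntegral_rpow hS hT hSpos ha hSa y
    have hq : ENNReal.ofReal (c * exp (-y))
        = ∫⁻ x in Set.Ioi 0, ENNReal.ofReal (a * x ^ (a - 1) * exp (-(x + y))) := by
      have h0 := ofReal_setIntegral_rpow hS hT hSpos ha hSa 0
      rw [Measure.restrict_eq_self_of_ae_mem (s := {ω | 0 < T ω}) hTpos] at h0
      rw [ENNReal.ofReal_mul hc0, hc, h0, ← lintegral_mul_const' _ _ ENNReal.ofReal_ne_top]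
      refine setLIntegral_congr_fun measurableSet_Ioi fun x hx ↦ ?_
      have hx : 0 < x := hx
      rw [hsurvS x hx, ← ENNReal.ofReal_mul (by positivity), mul_assoc, ← exp_add, neg_add]
    have hpq : ENNReal.ofReal (∫ ω in {ω | y < T ω}, S ω ^ a ∂μ)
        = ENNReal.ofReal (c * exp (-y)) + ENNReal.ofReal y * ∫⁻ x in Set.Ioi 0, f x y := by
      rw [hp, hq, ← lintegral_const_mul' _ _ ENNReal.ofReal_ne_top,
        ← lintegral_add_left (by fun_prop)]
      refine setLIntegral_congr_fun measurableSet_Ioi fun x hx ↦ ?_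
      have hx : 0 < x := hx
      have hxa := rpow_pos_of_pos hx (a - 1)
      obtain ⟨hBA, hA⟩ := hAexp x y hx hy
      have hle : exp (-(x + y)) ≤ exp (-((x + y) * A (x / (x + y)))) :=
        exp_le_exp.2 (by nlinarith)
      have hle' := sub_nonneg.2 hle
      simp only [f]
      rw [hsurv x y hx.le hy.le (by linarith), hBA, ← ENNReal.ofReal_mul hy.le,
        ← ENNReal.ofReal_add (by positivity) (by positivity)]
      congr 1
      field_simp
      ring
    have hnn : 0 ≤ ∫ ω in {ω | y < T ω}, S ω ^ a ∂μ :=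
      integral_nonneg_of_ae
        (ae_restrict_of_ae (hSpos.mono fun ω hω ↦ rpow_nonneg hω.le a))
    have hle : c * exp (-y) ≤ ∫ ω in {ω | y < T ω}, S ω ^ a ∂μ := by
      rw [← ENNReal.ofReal_le_ofReal_iff hnn, hpq]
      exact le_self_add
    refine ⟨mul_nonneg (inv_nonneg.2 hy.le) (sub_nonneg.2 hle), ?_⟩
    rw [ENNReal.ofReal_mul (inv_nonneg.2 hy.le), ENNReal.ofReal_sub _ (by positivity), hpq,
      ENNReal.add_sub_cancel_left ENNReal.ofReal_ne_top, ← mul_assoc,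
      ← ENNReal.ofReal_mul (inv_nonneg.2 hy.le), inv_mul_cancel₀ hy.ne', ENNReal.ofReal_one,
      one_mul]
  have hBw {w : ℝ} (hw : w ∈ Set.Ioo (0 : ℝ) 1) : B w = A w ∧ 0 < A w ∧ A w ≤ 1 := by
    have := hAbound w (Set.Ioo_subset_Icc_self hw)
    exact ⟨Set.indicator_of_mem hw A, hw.1.trans_le ((le_max_left _ _).trans this.1), this.2⟩
  rw [hLHS, setIntegral_congr_fun measurableSet_Ioi hinner,
    integral_eq_lintegral_of_nonneg_ae, setLIntegral_congr_fun measurableSet_Ioi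
      (fun y hy ↦ (hlint y hy).2), lintegral_lintegral_Ioi_eq_simplex hf,
    intervalIntegral.integral_of_le zero_le_one, integral_Ioc_eq_integral_Ioo,
    integral_eq_lintegral_of_nonneg_ae]
  · congr 1
    refine setLIntegral_congr_fun measurableSet_Ioo fun w hw ↦ ?_
    obtain ⟨hBA, hA0, hA1⟩ := hBw hw
    rw [← lintegral_simplex_radial ha hw hA0 hA1]
    refine setLIntegral_congr_fun measurableSet_Ioi fun r hr ↦ ?_
    have hr : 0 < r := hr
    have e1 : r * w + r * (1 - w) = r := by ring
    have e2 : r * w / r = w := by field_simp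
    simp only [f, e1, e2, hBA]
  · filter_upwards [ae_restrict_mem measurableSet_Ioo] with w hw
    obtain ⟨-, hA0, hA1⟩ := hBw hw
    have h1 := one_le_rpow_of_pos_of_le_one_of_nonpos hA0 hA1 (neg_nonpos.2 ha.le)
    have h2 := rpow_nonneg hw.1.le (a - 1)
    have h3 := rpow_nonneg (sub_pos.2 hw.2).le (-1)
    have h4 := Gamma_pos_of_pos (by linarith : 0 < a + 1)
    have h5 := sub_nonneg.2 h1
    simp only [Pi.zero_apply]
    positivity
  · have : Measurable fun w ↦
        Gamma (a + 1) * (B w ^ (-a) - 1) * w ^ (a - 1) * (1 - w) ^ (-1 : ℝ) := by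
      fun_prop
    refine this.aestronglyMeasurable.congr ?_
    filter_upwards [ae_restrict_mem measurableSet_Ioo] with w hw
    rw [(hBw hw).1]
  · filter_upwards [ae_restrict_mem measurableSet_Ioi] with y hy
    exact (hlint y hy).1
  · have : AEStronglyMeasurable (fun y ↦ (∫⁻ x in Set.Ioi 0, f x y).toReal)
        (volume.restrict (Set.Ioi 0)) :=
      (hf.lintegral_prod_left'
        (μ := volume.restrict (Set.Ioi 0))).ennreal_toReal.aestronglyMeasurable
    refine this.congr ?_
    filter_upwards [ae_restrict_mem measurableSet_Ioi] with y hy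
    rw [← (hlint y hy).2, ENNReal.toReal_ofReal (hlint y hy).1]
end

section
/- Let (S, T) have a min-stable distribution with unit exponential margins and Pickands dependence function A. Then H_{1,1}(0,0) = Cov(log S, log T) = ∫₀¹ (−log A(w))/(w(1−w)) dw (Tiago de Oliveira's formula). -/
open MeasureTheory Real Filter

/-- The signed indicator of the interval between `0` and `a`, whose integral is `a`. -/
noncomputable def signedStep (a v : ℝ) : ℝ :=
  (Set.Iio a).indicator 1 v - (Set.Iio (0 : ℝ)).indicator 1 v

lemma signedStep_eq (a : ℝ) :
    signedStep a = fun v => (Set.Ico 0 a).indicator 1 v - (Set.Ico a 0).indicator 1 v := by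
  ext v
  simp only [signedStep, Set.indicator_apply, Set.mem_Iio, Set.mem_Ico, Pi.one_apply]
  grind

lemma abs_signedStep_eq (a : ℝ) :
    (fun v => ‖signedStep a v‖) =
      fun v => (Set.Ico 0 a).indicator 1 v + (Set.Ico a 0).indicator 1 v := by
  ext v
  simp only [signedStep_eq, Set.indicator_apply, Set.mem_Ico, Pi.one_apply, Real.norm_eq_abs]
  split_ifs <;> first | (exfalso; grind) | norm_num

lemma integrable_indicator_one_Ico (a b : ℝ) :
    Integrable ((Set.Ico a b).indicator (1 : ℝ → ℝ)) := by
  rw [integrable_indicator_iff measurableSet_Ico]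
  exact integrableOn_const (by simp)

lemma integral_indicator_one_Ico (a b : ℝ) :
    ∫ v, (Set.Ico a b).indicator (1 : ℝ → ℝ) v = max (b - a) 0 := by
  rw [integral_indicator_one measurableSet_Ico]
  simp [measureReal_def, ENNReal.toReal_ofReal']

lemma integrable_signedStep (a : ℝ) : Integrable (signedStep a) := by
  rw [signedStep_eq]
  exact (integrable_indicator_one_Ico 0 a).sub (integrable_indicator_one_Ico a 0)

lemma integral_signedStep (a : ℝ) : ∫ v, signedStep a v = a := by
  rw [signedStep_eq, integral_sub (integrable_indicator_one_Ico 0 a)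
    (integrable_indicator_one_Ico a 0), integral_indicator_one_Ico, integral_indicator_one_Ico]
  rcases le_total a 0 with h | h <;> simp [h]

lemma integral_norm_signedStep (a : ℝ) : ∫ v, ‖signedStep a v‖ = |a| := by
  rw [abs_signedStep_eq, integral_add (integrable_indicator_one_Ico 0 a)
    (integrable_indicator_one_Ico a 0), integral_indicator_one_Ico, integral_indicator_one_Ico]
  rcases le_total a 0 with h | h <;> simp [h, abs_of_nonneg, abs_of_nonpos]

lemma measurable_uncurry_signedStep : Measurable (Function.uncurry signedStep) := by
  have h : Function.uncurry signedStep = fun p : ℝ × ℝ =>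
      {q : ℝ × ℝ | q.2 < q.1}.indicator (1 : ℝ × ℝ → ℝ) p
        - {q : ℝ × ℝ | q.2 < 0}.indicator (1 : ℝ × ℝ → ℝ) p := by
    ext ⟨a, v⟩
    simp [signedStep, Set.indicator_apply, Function.uncurry]
  rw [h]
  exact (measurable_one.indicator (measurableSet_lt measurable_snd measurable_fst)).sub
    (measurable_one.indicator (measurableSet_lt measurable_snd measurable_const))

section Covariance

variable {Ω : Type*} [MeasurableSpace Ω] {μ : Measure Ω}

lemma integrable_prod_signedStep {U : Ω → ℝ} (hU : Measurable U) (hUi : Integrable U μ) :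
    Integrable (fun p : Ω × ℝ => signedStep (U p.1) p.2) (μ.prod volume) := by
  have hm : Measurable (fun p : Ω × ℝ => signedStep (U p.1) p.2) :=
    measurable_uncurry_signedStep.comp ((hU.comp measurable_fst).prodMk measurable_snd)
  rw [integrable_prod_iff hm.aestronglyMeasurable]
  exact ⟨.of_forall fun ω => integrable_signedStep (U ω), by
    simpa only [integral_norm_signedStep] using hUi.abs⟩

lemma integrable_prod_signedStep_mul {U V : Ω → ℝ} (hU : Measurable U) (hV : Measurable V)
    (hUV : Integrable (fun ω => U ω * V ω) μ) :
    Integrable (fun p : Ω × (ℝ × ℝ) => signedStep (U p.1) p.2.1 * signedStep (V p.1) p.2.2)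
      (μ.prod volume) := by
  have hm : Measurable
      (fun p : Ω × (ℝ × ℝ) => signedStep (U p.1) p.2.1 * signedStep (V p.1) p.2.2) :=
    (measurable_uncurry_signedStep.comp
      ((hU.comp measurable_fst).prodMk (measurable_fst.comp measurable_snd))).mul
    (measurable_uncurry_signedStep.comp
      ((hV.comp measurable_fst).prodMk (measurable_snd.comp measurable_snd)))
  rw [integrable_prod_iff hm.aestronglyMeasurable]
  refine ⟨.of_forall fun ω =>
    (integrable_signedStep (U ω)).mul_prod (integrable_signedStep (V ω)), ?_⟩
  have h : ∀ ω, ∫ z : ℝ × ℝ, ‖signedStep (U ω) z.1 * signedStep (V ω) z.2‖ = |U ω * V ω| := by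
    intro ω
    simp only [norm_mul]
    rw [Measure.volume_eq_prod, integral_prod_mul (fun u => ‖signedStep (U ω) u‖)
      (fun v => ‖signedStep (V ω) v‖), integral_norm_signedStep, integral_norm_signedStep, abs_mul]
  simpa only [h] using hUV.abs

variable [IsProbabilityMeasure μ]

lemma integrable_indicator_one {s : Set Ω} (hs : MeasurableSet s) :
    Integrable (s.indicator (1 : Ω → ℝ)) μ :=
  (integrable_const (1 : ℝ)).indicator hs

lemma integral_signedStep_comp {U : Ω → ℝ} (hU : Measurable U) (v : ℝ) :
    ∫ ω, signedStep (U ω) v ∂μ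
      = μ.real {ω | v < U ω} - (Set.Iio (0 : ℝ)).indicator 1 v := by
  have hs : MeasurableSet {ω | v < U ω} := measurableSet_lt measurable_const hU
  have h : ∀ ω, (Set.Iio (U ω)).indicator (1 : ℝ → ℝ) v = {ω | v < U ω}.indicator 1 ω := by
    intro ω
    simp [Set.indicator_apply]
  simp only [signedStep, h]
  rw [integral_sub (integrable_indicator_one hs) (integrable_const _),
    integral_indicator_one hs]
  simp

lemma integrable_survival_sub {U : Ω → ℝ} (hU : Measurable U) (hUi : Integrable U μ) :
    Integrable (fun v => μ.real {ω | v < U ω} - (Set.Iio (0 : ℝ)).indicator 1 v) := by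
  simpa only [integral_signedStep_comp hU] using
    (integrable_prod_signedStep hU hUi).integral_prod_right

/-- The mean as an integral of the survival function. -/
lemma integral_survival_sub {U : Ω → ℝ} (hU : Measurable U) (hUi : Integrable U μ) :
    ∫ v, (μ.real {ω | v < U ω} - (Set.Iio (0 : ℝ)).indicator 1 v) = ∫ ω, U ω ∂μ := by
  have h := integral_integral_swap (f := fun ω v => signedStep (U ω) v)
    (integrable_prod_signedStep hU hUi)
  simpa only [integral_signedStep, integral_signedStep_comp hU] using h.symm

lemma integral_signedStep_mul_comp {U V : Ω → ℝ} (hU : Measurable U) (hV : Measurable V)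
    (u v : ℝ) :
    ∫ ω, signedStep (U ω) u * signedStep (V ω) v ∂μ
      = μ.real {ω | u < U ω ∧ v < V ω} - μ.real {ω | u < U ω} * μ.real {ω | v < V ω}
        + (μ.real {ω | u < U ω} - (Set.Iio (0 : ℝ)).indicator 1 u)
          * (μ.real {ω | v < V ω} - (Set.Iio (0 : ℝ)).indicator 1 v) := by
  have hsU : MeasurableSet {ω | u < U ω} := measurableSet_lt measurable_const hU
  have hsV : MeasurableSet {ω | v < V ω} := measurableSet_lt measurable_const hV
  have hsUV : MeasurableSet {ω | u < U ω ∧ v < V ω} := hsU.inter hsV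
  set a : ℝ := (Set.Iio (0 : ℝ)).indicator 1 u with ha
  set b : ℝ := (Set.Iio (0 : ℝ)).indicator 1 v with hb
  have h : ∀ ω, signedStep (U ω) u * signedStep (V ω) v =
      {ω | u < U ω ∧ v < V ω}.indicator 1 ω - b * {ω | u < U ω}.indicator 1 ω
        - a * {ω | v < V ω}.indicator 1 ω + a * b := by
    intro ω
    have h1 : signedStep (U ω) u = {ω | u < U ω}.indicator 1 ω - a := by
      simp [signedStep, Set.indicator_apply, ha]
    have h2 : signedStep (V ω) v = {ω | v < V ω}.indicator 1 ω - b := by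
      simp [signedStep, Set.indicator_apply, hb]
    have h3 : ({ω | u < U ω ∧ v < V ω}.indicator 1 ω : ℝ) =
        {ω | u < U ω}.indicator 1 ω * {ω | v < V ω}.indicator 1 ω := by
      simp only [Set.indicator_apply, Set.mem_ofPred_eq, Pi.one_apply]
      split_ifs <;> simp_all
    rw [h1, h2, h3]
    ring
  have iU := (integrable_indicator_one (μ := μ) hsU).const_mul b
  have iV := (integrable_indicator_one (μ := μ) hsV).const_mul a
  have iUV := integrable_indicator_one (μ := μ) hsUV
  simp only [h]
  rw [integral_add, integral_sub, integral_sub iUV iU, integral_const_mul, integral_const_mul,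
    integral_indicator_one hsU, integral_indicator_one hsV, integral_indicator_one hsUV]
  · simp only [integral_const, probReal_univ, smul_eq_mul]
    ring
  · exact iUV.sub iU
  · exact iV
  · exact (iUV.sub iU).sub iV
  · exact integrable_const _

/-- **Hoeffding's covariance formula**, integrability part. -/
lemma integrable_survival_sub_mul {U V : Ω → ℝ} (hU : Measurable U) (hV : Measurable V)
    (hUi : Integrable U μ) (hVi : Integrable V μ) (hUV : Integrable (fun ω => U ω * V ω) μ) :
    Integrable (fun z : ℝ × ℝ => μ.real {ω | z.1 < U ω ∧ z.2 < V ω}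
      - μ.real {ω | z.1 < U ω} * μ.real {ω | z.2 < V ω}) := by
  have h := (integrable_prod_signedStep_mul hU hV hUV).integral_prod_right
  simp only [integral_signedStep_mul_comp hU hV] at h
  have h' := h.sub ((integrable_survival_sub hU hUi).mul_prod (integrable_survival_sub hV hVi))
  refine h'.congr (.of_forall fun z => ?_)
  simp

/-- **Hoeffding's covariance formula**. -/
lemma integral_survival_sub_mul {U V : Ω → ℝ} (hU : Measurable U) (hV : Measurable V)
    (hUi : Integrable U μ) (hVi : Integrable V μ) (hUV : Integrable (fun ω => U ω * V ω) μ) :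
    ∫ z : ℝ × ℝ, (μ.real {ω | z.1 < U ω ∧ z.2 < V ω}
      - μ.real {ω | z.1 < U ω} * μ.real {ω | z.2 < V ω})
      = ∫ ω, U ω * V ω ∂μ - (∫ ω, U ω ∂μ) * ∫ ω, V ω ∂μ := by
  have hswap := integral_integral_swap
    (f := fun ω (z : ℝ × ℝ) => signedStep (U ω) z.1 * signedStep (V ω) z.2)
    (integrable_prod_signedStep_mul hU hV hUV)
  simp only [integral_signedStep_mul_comp hU hV] at hswap
  have hl : ∀ ω, ∫ z : ℝ × ℝ, signedStep (U ω) z.1 * signedStep (V ω) z.2 = U ω * V ω := by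
    intro ω
    rw [Measure.volume_eq_prod, integral_prod_mul (signedStep (U ω)) (signedStep (V ω)),
      integral_signedStep, integral_signedStep]
  rw [integral_add (integrable_survival_sub_mul hU hV hUi hVi hUV)
    ((integrable_survival_sub hU hUi).mul_prod (integrable_survival_sub hV hVi))] at hswap
  have hp : ∫ z : ℝ × ℝ, (μ.real {ω | z.1 < U ω} - (Set.Iio (0 : ℝ)).indicator 1 z.1)
      * (μ.real {ω | z.2 < V ω} - (Set.Iio (0 : ℝ)).indicator 1 z.2)
      = (∫ ω, U ω ∂μ) * ∫ ω, V ω ∂μ := by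
    rw [← integral_survival_sub hU hUi, ← integral_survival_sub hV hVi, Measure.volume_eq_prod]
    exact integral_prod_mul (fun u => μ.real {ω | u < U ω} - (Set.Iio (0 : ℝ)).indicator 1 u)
      (fun v => μ.real {ω | v < V ω} - (Set.Iio (0 : ℝ)).indicator 1 v)
  simp only [hl, hp] at hswap
  linarith

end Covariance

section Exponential

open ProbabilityTheory

lemma sq_log_le_rpow {x : ℝ} (hx : 0 < x) :
    log x ^ 2 ≤ 32 * (x ^ (1 / 2 : ℝ) + x ^ (-1 / 2 : ℝ)) := by
  have h1 : log x ≤ x ^ (1 / 4 : ℝ) / (1 / 4) := log_le_rpow_div hx.le (by norm_num)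
  have h2 : log x⁻¹ ≤ x⁻¹ ^ (1 / 4 : ℝ) / (1 / 4) :=
    log_le_rpow_div (inv_nonneg.2 hx.le) (by norm_num)
  have e1 : x ^ (1 / 2 : ℝ) = (x ^ (1 / 4 : ℝ)) ^ 2 := by
    rw [← rpow_mul_natCast hx.le]; norm_num
  have e2 : x ^ (-1 / 2 : ℝ) = (x⁻¹ ^ (1 / 4 : ℝ)) ^ 2 := by
    rw [← rpow_mul_natCast (inv_nonneg.2 hx.le), inv_rpow hx.le, ← rpow_neg hx.le]; norm_num
  rw [log_inv] at h2
  rw [e1, e2]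
  have p1 : 0 < x ^ (1 / 4 : ℝ) := rpow_pos_of_pos hx _
  have p2 : 0 < x⁻¹ ^ (1 / 4 : ℝ) := rpow_pos_of_pos (inv_pos.2 hx) _
  generalize x ^ (1 / 4 : ℝ) = a at *
  generalize x⁻¹ ^ (1 / 4 : ℝ) = b at *
  have h3 : |log x| ≤ 4 * (a + b) := abs_le.2 ⟨by linarith, by linarith⟩
  have h4 := pow_le_pow_left₀ (abs_nonneg _) h3 2
  rw [sq_abs] at h4
  nlinarith [sq_nonneg (a - b)]

lemma integrable_sq_log_expMeasure : Integrable (fun x => log x ^ 2) (expMeasure 1) := by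
  have hpdf : expMeasure 1 = volume.withDensity (exponentialPDF 1) := rfl
  have hG : IntegrableOn
      (fun x : ℝ => 32 * (exp (-x) * x ^ (3 / 2 - 1 : ℝ) + exp (-x) * x ^ (1 / 2 - 1 : ℝ)))
      (Set.Ioi 0) :=
    ((GammaIntegral_convergent (by norm_num)).add
      (GammaIntegral_convergent (by norm_num))).const_mul 32
  have hI : IntegrableOn (fun x => exp (-x) * log x ^ 2) (Set.Ioi 0) := by
    refine hG.mono' (by fun_prop) ?_
    filter_upwards [ae_restrict_mem measurableSet_Ioi] with x hx
    rw [Real.norm_of_nonneg (by positivity)]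
    have := mul_le_mul_of_nonneg_left (sq_log_le_rpow hx) (exp_pos (-x)).le
    norm_num at this ⊢
    linarith
  have hm : Measurable (exponentialPDF 1) := (measurable_exponentialPDFReal 1).ennreal_ofReal
  rw [hpdf, integrable_withDensity_iff hm (.of_forall fun x => ENNReal.ofReal_lt_top)]
  rw [← integrable_indicator_iff measurableSet_Ioi] at hI
  refine hI.congr ?_
  filter_upwards [Measure.ae_ne volume (0 : ℝ)] with x hx
  rw [exponentialPDF_eq]
  rcases lt_or_gt_of_ne hx with h | h
  · simp [h.not_ge, h.le]
  · rw [Set.indicator_of_mem (Set.mem_Ioi.2 h), if_pos h.le, ENNReal.toReal_ofReal (by positivity)]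
    simp [mul_comm]

variable {Ω : Type*} [MeasurableSpace Ω] {μ : Measure Ω} [IsProbabilityMeasure μ]

lemma map_eq_expMeasure {X : Ω → ℝ} (hX : Measurable X)
    (h : ∀ x, 0 ≤ x → μ.real {ω | x < X ω} = exp (-x)) : μ.map X = expMeasure 1 := by
  have := isProbabilityMeasure_expMeasure (zero_lt_one' ℝ)
  have := Measure.isProbabilityMeasure_map (μ := μ) hX.aemeasurable
  refine Measure.eq_of_cdf _ _ (StieltjesFunction.ext fun x => ?_)
  have hc : ∀ x, μ.real (X ⁻¹' Set.Iic x) = 1 - μ.real {ω | x < X ω} := by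
    intro x
    rw [← probReal_compl_eq_one_sub (measurableSet_lt measurable_const hX)]
    congr 1
    ext ω
    simp
  rw [cdf_expMeasure_eq zero_lt_one, cdf_eq_real,
    map_measureReal_apply hX measurableSet_Iic]
  split_ifs with hx
  · rw [hc, h x hx, one_mul]
  · refine le_antisymm ?_ measureReal_nonneg
    calc μ.real (X ⁻¹' Set.Iic x) ≤ μ.real (X ⁻¹' Set.Iic 0) :=
          measureReal_mono (Set.preimage_mono (Set.Iic_subset_Iic.2 (not_le.1 hx).le))
      _ = 0 := by rw [hc, h 0 le_rfl]; simp

lemma memLp_log_of_survival {X : Ω → ℝ} (hX : Measurable X)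
    (h : ∀ x, 0 ≤ x → μ.real {ω | x < X ω} = exp (-x)) :
    MemLp (fun ω => log (X ω)) 2 μ := by
  have hm : Measurable fun ω => log (X ω) := measurable_log.comp hX
  rw [memLp_two_iff_integrable_sq hm.aestronglyMeasurable]
  have hi := integrable_sq_log_expMeasure
  rw [← map_eq_expMeasure hX h] at hi
  exact hi.comp_measurable hX

lemma real_lt_log {Ω : Type*} [MeasurableSpace Ω] {μ : Measure Ω} {X : Ω → ℝ}
    (hpos : ∀ᵐ ω ∂μ, 0 < X ω)
    (h : ∀ x, 0 ≤ x → μ.real {ω | x < X ω} = exp (-x)) (v : ℝ) :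
    μ.real {ω | v < log (X ω)} = exp (-exp v) := by
  rw [← h _ (exp_pos v).le]
  refine measureReal_congr ?_
  filter_upwards [hpos] with ω hω
  exact propext (lt_log_iff_exp_lt hω)

/-- **Frullani's integral** for the exponential function, in logarithmic coordinates. The
probability space only has to carry a unit exponential variable. -/
lemma integral_exp_neg_exp_sub {X : Ω → ℝ} (hX : Measurable X) (hpos : ∀ᵐ ω ∂μ, 0 < X ω)
    (h : ∀ x, 0 ≤ x → μ.real {ω | x < X ω} = exp (-x)) (α β : ℝ) :
    ∫ v, (exp (-exp (v + α)) - exp (-exp (v + β))) = β - α := by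
  have hlog : Measurable fun ω => log (X ω) := measurable_log.comp hX
  have hi : Integrable (fun ω => log (X ω)) μ :=
    (memLp_log_of_survival hX h).integrable (by norm_num)
  have hsurv : ∀ c v, μ.real {ω | v < log (X ω) - c} = exp (-exp (v + c)) := by
    intro c v
    simp only [lt_sub_iff_add_lt]
    exact real_lt_log hpos h _
  have hc : ∀ c, Integrable (fun v => exp (-exp (v + c)) - (Set.Iio (0 : ℝ)).indicator 1 v) ∧
      ∫ v, (exp (-exp (v + c)) - (Set.Iio (0 : ℝ)).indicator 1 v) = ∫ ω, log (X ω) ∂μ - c := by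
    intro c
    have h1 := integrable_survival_sub (hlog.sub_const c) (hi.sub (integrable_const c))
    have h2 := integral_survival_sub (hlog.sub_const c) (hi.sub (integrable_const c))
    rw [integral_sub hi (integrable_const c)] at h2
    simp only [hsurv] at h1 h2
    exact ⟨h1, by simpa using h2⟩
  have hd := integral_sub (hc α).1 (hc β).1
  rw [(hc α).2, (hc β).2] at hd
  simp only [sub_sub_sub_cancel_right] at hd
  rw [hd]
  ring

end Exponential

lemma integral_comp_sigmoid (g : ℝ → ℝ) :
    ∫ b, g (sigmoid b) = ∫ w in (0 : ℝ)..1, g w / (w * (1 - w)) := by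
  have h := integral_image_eq_integral_abs_deriv_smul (s := Set.univ) MeasurableSet.univ
    (fun x _ => (hasDerivAt_sigmoid x).hasDerivWithinAt) sigmoid_injective.injOn
    (fun w => g w / (w * (1 - w)))
  rw [Set.image_univ, range_sigmoid, setIntegral_univ] at h
  rw [intervalIntegral.integral_of_le zero_le_one, integral_Ioc_eq_integral_Ioo, h]
  refine integral_congr_ae (.of_forall fun b => ?_)
  have hb : 0 < sigmoid b * (1 - sigmoid b) :=
    mul_pos (sigmoid_pos b) (sub_pos.2 (sigmoid_lt_one b))
  simp only [smul_eq_mul, abs_of_pos hb, mul_div_cancel₀ _ hb.ne']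

theorem minStable_cov_log_log
    {Ω : Type*} [MeasurableSpace Ω] (μ : Measure Ω) [IsProbabilityMeasure μ]
    (S T : Ω → ℝ) (hS : Measurable S) (hT : Measurable T)
    (A : ℝ → ℝ)
    (hAconv : ConvexOn ℝ (Set.Icc (0:ℝ) 1) A)
    (hAbound : ∀ w ∈ Set.Icc (0:ℝ) 1, max w (1 - w) ≤ A w ∧ A w ≤ 1)
    (hsurv : ∀ x y : ℝ, 0 ≤ x → 0 ≤ y → (x, y) ≠ (0, 0) →
      (μ {ω | x < S ω ∧ y < T ω}).toReal = Real.exp (-((x + y) * A (x / (x + y)))))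
    :
    (∫ ω, Real.log (S ω) * Real.log (T ω) ∂μ)
        - (∫ ω, Real.log (S ω) ∂μ) * (∫ ω, Real.log (T ω) ∂μ)
      = ∫ w in (0:ℝ)..1, (- Real.log (A w)) / (w * (1 - w)) := by
  have hA0 : A 0 = 1 := by
    have := hAbound 0 (by simp)
    norm_num at this
    linarith
  have hA1 : A 1 = 1 := by
    have := hAbound 1 (by simp)
    norm_num at this
    linarith
  have hSx : ∀ x, 0 < x → μ.real {ω | x < S ω ∧ 0 < T ω} = exp (-x) := fun x hx => by
    simpa [hx.ne', hA1] using! hsurv x 0 hx.le le_rfl (by simp [hx.ne'])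
  have hTy : ∀ y, 0 < y → μ.real {ω | 0 < S ω ∧ y < T ω} = exp (-y) := fun y hy => by
    simpa [hy.ne', hA0] using! hsurv 0 y le_rfl hy.le (by simp [hy.ne'])
  have hone : μ.real {ω | 0 < S ω ∧ 0 < T ω} = 1 := by
    refine le_antisymm measureReal_le_one ?_
    have hlim : Tendsto (fun x : ℝ => exp (-x)) (nhdsWithin 0 (Set.Ioi 0)) (nhds 1) := by
      have : Continuous fun x : ℝ => exp (-x) := by fun_prop
      simpa using (this.tendsto 0).mono_left nhdsWithin_le_nhds
    refine le_of_tendsto hlim ?_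
    filter_upwards [self_mem_nhdsWithin] with x hx
    rw [← hSx x hx]
    exact measureReal_mono fun ω hω => ⟨lt_trans hx hω.1, hω.2⟩
  have hpos : ∀ᵐ ω ∂μ, 0 < S ω ∧ 0 < T ω := by
    have hm : MeasurableSet {ω | 0 < S ω ∧ 0 < T ω} :=
      (measurableSet_lt measurable_const hS).inter (measurableSet_lt measurable_const hT)
    have h0 := probReal_compl_eq_one_sub (μ := μ) hm
    rw [hone, sub_self, measureReal_eq_zero_iff] at h0
    exact h0
  have hposS : ∀ᵐ ω ∂μ, 0 < S ω := hpos.mono fun _ h => h.1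
  have hposT : ∀ᵐ ω ∂μ, 0 < T ω := hpos.mono fun _ h => h.2
  have hSexp : ∀ x, 0 ≤ x → μ.real {ω | x < S ω} = exp (-x) := by
    intro x hx
    have he : μ.real {ω | x < S ω} = μ.real {ω | x < S ω ∧ 0 < T ω} := by
      refine measureReal_congr ?_
      filter_upwards [hposT] with ω hω
      exact propext (and_iff_left hω).symm
    rcases hx.eq_or_lt with rfl | hx
    · simpa [hone] using he
    · rw [he, hSx x hx]
  have hTexp : ∀ x, 0 ≤ x → μ.real {ω | x < T ω} = exp (-x) := by
    intro x hx
    have he : μ.real {ω | x < T ω} = μ.real {ω | 0 < S ω ∧ x < T ω} := by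
      refine measureReal_congr ?_
      filter_upwards [hposS] with ω hω
      exact propext (and_iff_right hω).symm
    rcases hx.eq_or_lt with rfl | hx
    · simpa [hone] using he
    · rw [he, hTy x hx]
  have hjoint : ∀ u v : ℝ, μ.real {ω | u < log (S ω) ∧ v < log (T ω)}
      = exp (-((exp u + exp v) * A (exp u / (exp u + exp v)))) := by
    intro u v
    rw [← hsurv (exp u) (exp v) (exp_pos u).le (exp_pos v).le (by simp)]
    refine measureReal_congr ?_
    filter_upwards [hpos] with ω hω
    exact propext (and_congr (lt_log_iff_exp_lt hω.1) (lt_log_iff_exp_lt hω.2))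
  have hUm : Measurable fun ω => log (S ω) := measurable_log.comp hS
  have hVm : Measurable fun ω => log (T ω) := measurable_log.comp hT
  have hU2 := memLp_log_of_survival hS hSexp
  have hV2 := memLp_log_of_survival hT hTexp
  have hUi : Integrable (fun ω => log (S ω)) μ := hU2.integrable (by norm_num)
  have hVi : Integrable (fun ω => log (T ω)) μ := hV2.integrable (by norm_num)
  have hUV : Integrable (fun ω => log (S ω) * log (T ω)) μ := hU2.integrable_mul hV2
  have hGi := integrable_survival_sub_mul hUm hVm hUi hVi hUV
  rw [← integral_survival_sub_mul hUm hVm hUi hVi hUV]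
  simp only [hjoint, real_lt_log hposS hSexp, real_lt_log hposT hTexp] at hGi ⊢
  have hmp : MeasurePreserving (MeasurableEquiv.shearAddRight ℝ) (volume : Measure (ℝ × ℝ))
      volume := measurePreserving_prod_add volume volume
  rw [← hmp.integral_comp']
  have hGi' := hmp.integrable_comp_of_integrable hGi
  rw [Measure.volume_eq_prod] at hGi' ⊢
  refine (integral_prod_symm _ hGi').trans ?_
  rw [← integral_comp_sigmoid fun w => -log (A w),
    ← integral_neg_eq_self]
  refine integral_congr_ae (.of_forall fun b => ?_)
  set w := sigmoid b with hw
  have hwmem : w ∈ Set.Icc (0 : ℝ) 1 := ⟨sigmoid_nonneg b, sigmoid_le_one b⟩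
  have hApos : 0 < A w := by
    have hmax := (hAbound w hwmem).1
    have h1 := le_max_left w (1 - w)
    exact lt_of_lt_of_le (sigmoid_pos b) (h1.trans hmax)
  have hc : 0 < 1 + exp (-b) := by positivity
  have hfr := integral_exp_neg_exp_sub hS hposS hSexp
    (log ((1 + exp (-b)) * A w)) (log (1 + exp (-b)))
  rw [show log (1 + exp (-b)) - log ((1 + exp (-b)) * A w) = -log (A w) by
    rw [log_mul hc.ne' hApos.ne']; ring] at hfr
  refine Eq.trans (integral_congr_ae (.of_forall fun a => ?_)) hfr
  have hsum : exp a + exp (a + -b) = exp a * (1 + exp (-b)) := by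
    rw [exp_add]
    ring
  have hdiv : exp a / (exp a * (1 + exp (-b))) = w := by
    rw [hw, sigmoid_def]
    field_simp
  have hshear : MeasurableEquiv.shearAddRight ℝ (a, -b) = (a, a + -b) := rfl
  simp only [Function.comp_apply, hshear, ← exp_add (-exp a), ← neg_add, hsum, hdiv]
  rw [exp_add a (log _), exp_add a (log _), exp_log hc, exp_log (mul_pos hc hApos), mul_assoc]
end
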